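/- There exist matrices C₀, C₁, …, C₇ on 4 qubits, each lying in the submonoid of 16 × 16 complex matrices generated by the Clifford gate embeddings H_i, S_i, S_i†, CNOT_{i,j}, and phase layers P₁, …, P₇ on 4 qubits whose total number of non-identity tensor factors over all seven layers is at most 20, such that the 4-MCT matrix equals C₀ · P₁ · C₁ · P₂ · ⋯ · P₇ · C₇; that is, the 4-MCT gate admits an ancilla-free Clifford+Z_N realization with phase count 20 and phase depth 7. -/

import Mathlib

/-!
Gates are represented as matrices indexed by `Bool` (single qubit, so a 2×2 matrix)
or by `Fin n → Bool` (n qubits, so a 2^n × 2^n matrix). The basis index `true`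
corresponds to the basis state |1⟩ and `false` to |0⟩.
-/

namespace MCT

/-- The Hadamard gate `H = (1/√2)·[[1,1],[1,−1]]`. -/
noncomputable def Hg : Matrix Bool Bool ℂ :=
  fun a b => (1 / (Real.sqrt 2 : ℂ)) * (if a && b then -1 else 1)

/-- The phase gate `Z_N = diag(1, exp(iπ/N))`. -/
noncomputable def Zg (N : ℕ) : Matrix Bool Bool ℂ :=
  fun a b => if a = b then (if a then Complex.exp (Real.pi * Complex.I / N) else 1) else 0

/-- The adjoint phase gate `Z_N† = diag(1, exp(−iπ/N))`. -/
noncomputable def Zgd (N : ℕ) : Matrix Bool Bool ℂ :=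
  fun a b => if a = b then (if a then Complex.exp (-(Real.pi * Complex.I) / N) else 1) else 0

/-- Embedding `G_i = I₂^{⊗(i−1)} ⊗ G ⊗ I₂^{⊗(n−i)}` of a single-qubit gate `G`
on qubit `i` of `n` qubits. -/
noncomputable def embed {n : ℕ} (G : Matrix Bool Bool ℂ) (i : Fin n) :
    Matrix (Fin n → Bool) (Fin n → Bool) ℂ :=
  fun x y => (if ∀ j, j ≠ i → x j = y j then 1 else 0) * G (x i) (y i)

/-- `CNOT_{i,j}`: the permutation matrix mapping the basis state `y` to the state
with `y j` replaced by `y j ⊕ y i` (control `i`, target `j`). -/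
def cnot {n : ℕ} (i j : Fin n) : Matrix (Fin n → Bool) (Fin n → Bool) ℂ :=
  fun x y => if (∀ k, k ≠ j → x k = y k) ∧ x j = xor (y j) (y i) then 1 else 0

/-- The function on basis states realized by the `n`-MCT gate: the last bit is
XORed with the product (conjunction) of the first `n−1` bits. -/
def mctFun (n : ℕ) (y : Fin n → Bool) : Fin n → Bool :=
  fun k => if (k : ℕ) = n - 1 then
      xor (y k) (decide (∀ j : Fin n, (j : ℕ) < n - 1 → y j = true))
    else y k

/-- The `n`-MCT matrix: the permutation matrix mapping basis state
`|x₁…x_n⟩` to `|x₁…x_{n−1}, x_n ⊕ (x₁⋯x_{n−1})⟩`. -/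
def mct (n : ℕ) : Matrix (Fin n → Bool) (Fin n → Bool) ℂ :=
  fun x y => if x = mctFun n y then 1 else 0

/-- The Clifford generators on `n` qubits: the embeddings `H_i`, `S_i = (Z₂)_i`,
`S_i† = (Z₂†)_i`, and `CNOT_{i,j}` for `i ≠ j`. -/
def cliffordGens (n : ℕ) : Set (Matrix (Fin n → Bool) (Fin n → Bool) ℂ) :=
  {M | (∃ i, M = embed Hg i)
     ∨ (∃ i, M = embed (Zg 2) i)
     ∨ (∃ i, M = embed (Zgd 2) i)
     ∨ (∃ i j, i ≠ j ∧ M = cnot i j)}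

/-- The phase layer `D₁ ⊗ ⋯ ⊗ D_n` where `D_i = diag(1, e i)`. -/
def phaseLayer {n : ℕ} (e : Fin n → ℂ) : Matrix (Fin n → Bool) (Fin n → Bool) ℂ :=
  fun x y => if x = y then ∏ i, (if x i then e i else 1) else 0

/-- `z` is a valid phase-layer factor: `diag(1, z)` equals the identity, a `Z_{2^k}`
gate, or an adjoint thereof, i.e. `z = exp(iπ m / 2^k)` for some integers `m`, `k ≥ 0`. -/
def validFactor (z : ℂ) : Prop :=
  ∃ (m : ℤ) (k : ℕ), z = Complex.exp (Real.pi * Complex.I * m / 2 ^ k)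

theorem embed_mul_apply {n : ℕ} (G : Matrix Bool Bool ℂ) (i : Fin n)
    (A : Matrix (Fin n → Bool) (Fin n → Bool) ℂ) (x y : Fin n → Bool) :
    (embed G i * A) x y = ∑ b, G (x i) b * A (Function.update x i b) y := by
  rw [Matrix.mul_apply]
  symm
  refine Finset.sum_of_injOn (fun b => Function.update x i b)
    (Function.update_injective x i).injOn (by simp) ?_ ?_
  · intro z _ hz
    have h : ¬ ∀ j, j ≠ i → x j = z j := by
      intro h
      refine hz ⟨z i, by simp, ?_⟩
      ext j
      by_cases hj : j = i
      · subst hj; simp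
      · simp [hj, h j hj]
    simp only [embed, if_neg h, zero_mul]
  · intro b _
    have h : ∀ j, j ≠ i → x j = Function.update x i b j := by
      intro j hj
      simp [hj]
    simp only [embed, if_pos h, one_mul, Function.update_self]

/-- The action of `cnot i j` on basis states. -/
def cnotFun {n : ℕ} (i j : Fin n) (y : Fin n → Bool) : Fin n → Bool :=
  Function.update y j (xor (y j) (y i))

theorem cnot_apply {n : ℕ} (i j : Fin n) (x y : Fin n → Bool) :
    cnot i j x y = if x = cnotFun i j y then 1 else 0 := by
  simp only [cnot, cnotFun, Function.eq_update_iff]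
  congr 1
  exact propext and_comm

theorem cnotFun_involutive {n : ℕ} {i j : Fin n} (h : i ≠ j) :
    Function.Involutive (cnotFun i j) := by
  intro y
  simp [cnotFun, h]

theorem cnot_mul_diagonal_mul_cnot {n : ℕ} {i j : Fin n} (h : i ≠ j)
    (d : (Fin n → Bool) → ℂ) :
    cnot i j * Matrix.diagonal d * cnot i j = Matrix.diagonal (d ∘ cnotFun i j) := by
  ext x y
  simp only [Matrix.mul_apply, cnot_apply, Matrix.diagonal_apply,
    Function.comp_apply]
  simp [cnotFun_involutive h y, eq_comm]
  aesop

/-- The matrix of a CNOT circuit, given as a word of (control, target) pairs whose last letter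
acts first. -/
def cnotWord {n : ℕ} (L : List (Fin n × Fin n)) : Matrix (Fin n → Bool) (Fin n → Bool) ℂ :=
  (L.map fun p => cnot p.1 p.2).prod

/-- The action of `cnotWord L` on basis states. -/
def cnotWordFun {n : ℕ} (L : List (Fin n × Fin n)) (y : Fin n → Bool) : Fin n → Bool :=
  L.foldr (fun p => cnotFun p.1 p.2) y

theorem cnotWord_mem_closure {n : ℕ} {L : List (Fin n × Fin n)} (hL : ∀ p ∈ L, p.1 ≠ p.2) :
    cnotWord L ∈ Submonoid.closure (cliffordGens n) := by
  refine Submonoid.list_prod_mem _ fun M hM => ?_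
  obtain ⟨p, hp, rfl⟩ := List.mem_map.mp hM
  exact Submonoid.subset_closure (Or.inr (Or.inr (Or.inr ⟨p.1, p.2, hL p hp, rfl⟩)))

theorem cnotWord_reverse_mul_diagonal_mul {n : ℕ} {L : List (Fin n × Fin n)}
    (hL : ∀ p ∈ L, p.1 ≠ p.2) (d : (Fin n → Bool) → ℂ) :
    cnotWord L.reverse * Matrix.diagonal d * cnotWord L =
      Matrix.diagonal (d ∘ cnotWordFun L) := by
  induction L generalizing d with
  | nil => simp [cnotWord, cnotWordFun, Function.comp_def]
  | cons p L ih =>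
    rw [List.forall_mem_cons] at hL
    have h := ih hL.2 (d ∘ cnotFun p.1 p.2)
    rw [← cnot_mul_diagonal_mul_cnot hL.1] at h
    simp only [cnotWord, List.reverse_cons, List.map_append, List.map_cons, List.map_nil,
      List.prod_append, List.prod_cons, List.prod_nil, mul_one, mul_assoc] at h ⊢
    exact h

theorem phaseLayer_pow_eq_diagonal {n : ℕ} (ω : ℂ) (m : Fin n → ℕ) :
    phaseLayer (fun i => ω ^ m i) =
      Matrix.diagonal fun x => ω ^ ∑ i, if x i then m i else 0 := by
  ext x y
  simp only [phaseLayer, Matrix.diagonal_apply, ← Finset.prod_pow_eq_pow_sum, pow_ite, pow_zero]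

theorem phaseLayer_one {n : ℕ} : phaseLayer (1 : Fin n → ℂ) = 1 := by
  ext x y
  simp [phaseLayer, Matrix.one_apply]

theorem mct_four_eq_hadamard_conj :
    mct 4 = embed Hg 3 * Matrix.diagonal (fun x => if ∀ i, x i = true then -1 else 1) *
      embed Hg 3 := by
  have hs : ((Real.sqrt 2 : ℝ) : ℂ)⁻¹ * ((Real.sqrt 2 : ℝ) : ℂ)⁻¹ = 1 / 2 := by
    rw [← mul_inv, ← Complex.ofReal_mul, Real.mul_self_sqrt zero_le_two]
    norm_num
  ext x y
  rw [mul_assoc, embed_mul_apply]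
  have hm : x = mctFun 4 y ↔ (x 0 = y 0 ∧ x 1 = y 1 ∧ x 2 = y 2) ∧
      x 3 = xor (y 3) (y 0 && y 1 && y 2) := by
    rw [funext_iff, Fin.forall_fin_succ, Fin.forall_fin_succ, Fin.forall_fin_succ]
    simp [mctFun, Fin.forall_fin_succ, and_assoc, Bool.and_assoc]
  have he (b : Bool) : (∀ j : Fin 4, j ≠ 3 → Function.update x 3 b j = y j) ↔
      x 0 = y 0 ∧ x 1 = y 1 ∧ x 2 = y 2 := by
    simp [Fin.forall_fin_succ, Function.update_apply]
  have hd (b : Bool) : (∀ j : Fin 4, Function.update x 3 b j = true) ↔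
      (x 0 && x 1 && x 2) = true ∧ b = true := by
    simp [Fin.forall_fin_succ, Function.update_apply, and_assoc]
  simp only [mct, hm, Fintype.sum_bool, Matrix.diagonal_mul, embed, he, hd, Function.update_self]
  by_cases h : x 0 = y 0 ∧ x 1 = y 1 ∧ x 2 = y 2
  · rw [h.1, h.2.1, h.2.2]
    generalize (y 0 && y 1 && y 2) = c
    cases c <;> cases x 3 <;> cases y 3 <;> simp [Hg, hs] <;> norm_num
  · simp [h]

/-- The CNOT words preparing, layer by layer, the nonzero parities of four bits. -/
def parityWord : Fin 4 → List (Fin 4 × Fin 4) :=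
  ![[], [(0, 3), (3, 2), (2, 1), (1, 0)], [(1, 2), (0, 3), (3, 1), (2, 0)],
    [(1, 3), (3, 0), (2, 1), (0, 1)]]

/-- The exponents, modulo 16, of `exp (iπ/8)` attached to the parities of `parityWord`:
`1` on parities of odd weight and `-1` on parities of even weight. -/
def parityExponent : Fin 4 → Fin 4 → ℕ :=
  ![![1, 1, 1, 1], ![15, 15, 15, 1], ![15, 15, 1, 1], ![15, 1, 0, 15]]

theorem parityWord_ne : ∀ k, ∀ p ∈ parityWord k, p.1 ≠ p.2 := by
  decide

theorem sum_parityExponent_mod (x : Fin 4 → Bool) :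
    (∑ k, ∑ i, if cnotWordFun (parityWord k) x i then parityExponent k i else 0) % 16 =
      if ∀ i, x i = true then 8 else 0 := by
  revert x
  decide

theorem diagonal_eq_parity_layers {ω : ℂ} (hω : ω ^ 8 = -1) :
    Matrix.diagonal (fun x : Fin 4 → Bool => if ∀ i, x i = true then (-1 : ℂ) else 1) =
      (List.ofFn fun k => cnotWord (parityWord k).reverse *
        phaseLayer (fun i => ω ^ parityExponent k i) * cnotWord (parityWord k)).prod := by
  have h16 : ω ^ 16 = 1 := by
    rw [show 16 = 8 * 2 from rfl, pow_mul, hω]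
    norm_num
  simp only [phaseLayer_pow_eq_diagonal, cnotWord_reverse_mul_diagonal_mul (parityWord_ne _)]
  simp only [List.ofFn_succ, List.ofFn_zero, List.prod_cons, List.prod_nil, mul_one,
    Matrix.diagonal_mul_diagonal, Function.comp_apply, ← pow_add]
  congr 1
  funext x
  have h := sum_parityExponent_mod x
  rw [Fin.sum_univ_four] at h
  trans ω ^ (if ∀ i, x i = true then 8 else 0)
  · split_ifs <;> simp [hω]
  · rw [← h, ← pow_eq_pow_mod _ h16]
    simp only [pow_add, mul_assoc]
    rfl

/-- The `4`-MCT gate admits an ancilla-free layered Clifford+`Z_N` realization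
`C₀ · P₁ · C₁ · P₂ ⋯ P₇ · C₇` with phase depth `7`, where each `C_i` lies in the
submonoid generated by the Clifford gate embeddings on 4 qubits, each `P_j` is a
phase layer, and the total number of non-identity tensor factors over the seven
phase layers (the phase count) is at most `20`. -/
theorem mct4_cliffordZN_phase_count_20_depth_7 :
    ∃ (C : Fin 8 → Matrix (Fin 4 → Bool) (Fin 4 → Bool) ℂ)
      (e : Fin 7 → Fin 4 → ℂ),
      (∀ i, C i ∈ Submonoid.closure (cliffordGens 4)) ∧
      (∀ j i, validFactor (e j i)) ∧
      (∑ j : Fin 7, Nat.card {i : Fin 4 // e j i ≠ 1}) ≤ 20 ∧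
      mct 4 = C 0 * (List.ofFn (fun j : Fin 7 => phaseLayer (e j) * C j.succ)).prod := by
  let ω : ℂ := Complex.exp (Real.pi * Complex.I / 8)
  have hω : ω ^ 8 = -1 := by
    rw [← Complex.exp_nat_mul, ← Complex.exp_pi_mul_I]
    congr 1
    push_cast
    ring
  have hH : embed Hg 3 ∈ Submonoid.closure (cliffordGens 4) :=
    Submonoid.subset_closure (Or.inl ⟨3, rfl⟩)
  have hW (k : Fin 4) : cnotWord (parityWord k) ∈ Submonoid.closure (cliffordGens 4) :=
    cnotWord_mem_closure (parityWord_ne k)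
  have hW' (k : Fin 4) : cnotWord (parityWord k).reverse ∈ Submonoid.closure (cliffordGens 4) :=
    cnotWord_mem_closure fun p hp => parityWord_ne k p (List.mem_reverse.mp hp)
  let e : Fin 4 → Fin 4 → ℂ := fun k i => ω ^ parityExponent k i
  refine ⟨![embed Hg 3 * cnotWord (parityWord 0).reverse,
      cnotWord (parityWord 0) * cnotWord (parityWord 1).reverse,
      cnotWord (parityWord 1) * cnotWord (parityWord 2).reverse,
      cnotWord (parityWord 2) * cnotWord (parityWord 3).reverse,
      cnotWord (parityWord 3) * embed Hg 3, 1, 1, 1],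
    ![e 0, e 1, e 2, e 3, 1, 1, 1], ?_, ?_, ?_, ?_⟩
  · intro i
    fin_cases i
    exacts [mul_mem hH (hW' 0), mul_mem (hW 0) (hW' 1), mul_mem (hW 1) (hW' 2),
      mul_mem (hW 2) (hW' 3), mul_mem (hW 3) hH, one_mem _, one_mem _, one_mem _]
  · have he (k i : Fin 4) : validFactor (e k i) := by
      refine ⟨parityExponent k i, 3, ?_⟩
      simp only [e, ω, ← Complex.exp_nat_mul]
      congr 1
      push_cast
      ring
    have h1 (i : Fin 4) : validFactor ((1 : Fin 4 → ℂ) i) := ⟨0, 0, by simp⟩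
    intro j
    fin_cases j
    exacts [he 0, he 1, he 2, he 3, h1, h1, h1]
  · have h4 (f : Fin 4 → ℂ) : Nat.card {i : Fin 4 // f i ≠ 1} ≤ 4 :=
      (Finite.card_subtype_le fun i => f i ≠ 1).trans (by simp)
    have h0 : Nat.card {i : Fin 4 // (1 : Fin 4 → ℂ) i ≠ 1} = 0 := by simp
    rw [Fin.sum_univ_seven]
    have := h4 (e 0)
    have := h4 (e 1)
    have := h4 (e 2)
    have := h4 (e 3)
    simp only [Matrix.cons_val]
    omega
  · rw [mct_four_eq_hadamard_conj, diagonal_eq_parity_layers hω]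
    simp [List.ofFn_succ, phaseLayer_one, mul_assoc, e]

end MCT
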